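/- arXiv:1210.3556 — 4 statements merged into one kernel-verified Lean document; each statement's English description precedes it below -/
import Mathlib

section
/- Approximation of the displacement distribution by sample displacements of nearby homeomorphisms: Let Φ be a lift of an orientation-preserving circle homeomorphism with irrational rotation number, let μ be the unique invariant Borel probability measure of the induced homeomorphism φ, and let μ_Ψ = ψ̄_*μ. For every ε > 0 there exists δ > 0 such that for every lift Φ̃ of an orientation-preserving circle homeomorphism with sup_{x∈ℝ} |Φ(x) − Φ̃(x)| < δ, every x₀ ∈ ℝ, and every 1-Lipschitz function f : ℝ → ℝ, one has limsup_{n→∞} |(1/n) Σ_{i=0}^{n−1} f(Φ̃^{i+1}(x₀) − Φ̃^{i}(x₀)) − ∫_{ℝ/ℤ} f ∘ ψ̄ dμ| < ε. -/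
open Filter MeasureTheory

lemma sdd_shift_sum (q : ℕ) (W : ℤ → ℝ) (d : ℝ) (hW : ∀ k, W (k + q) = W k + d) (c : ℤ) :
    ∑ k ∈ Finset.range q, W (k + (c + 1)) = ∑ k ∈ Finset.range q, W (k + c) + d := by
  have h1 := Finset.sum_range_succ (fun k : ℕ => W (k + c)) q
  have h2 := Finset.sum_range_succ' (fun k : ℕ => W (k + c)) q
  have h3 := hW c
  push_cast at h2
  have h4 : ∀ k : ℕ, W ((k : ℤ) + 1 + c) = W (k + (c + 1)) := fun k => by congr 1; ring
  simp only [h4] at h2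
  rw [add_comm c (q : ℤ)] at h3
  rw [zero_add] at h2
  linarith

lemma sdd_periodic_sum (q : ℕ) (W : ℤ → ℝ) (hW : ∀ k, W (k + q) = W k) (c : ℤ) :
    ∑ k ∈ Finset.range q, W (k + c) = ∑ k ∈ Finset.range q, W k := by
  have hs : ∀ c : ℤ, ∑ k ∈ Finset.range q, W (k + (c + 1)) = ∑ k ∈ Finset.range q, W (k + c) :=
    fun c => by simpa using sdd_shift_sum q W 0 (by simpa using hW) c
  induction c using Int.induction_on with
  | zero => simp
  | succ i ih => rw [hs, ih]
  | pred i ih => rw [← ih, ← hs (-i - 1)]; simp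

lemma sdd_emod_sum (q : ℕ) (hq : 0 < q) (W : ℤ → ℝ) (hW : ∀ k, W (k + q) = W k) (p u : ℤ)
    (hu : (p * u) % q = 1 % q) :
    ∑ i ∈ Finset.range q, W (i * p) = ∑ k ∈ Finset.range q, W k := by
  have hq' : (0 : ℤ) < q := by exact_mod_cast hq
  have hz : ∀ (k n : ℤ), W (k + n * q) = W k := by
    intro k n
    have : Function.Periodic W (q : ℤ) := hW
    exact this.int_mul n k
  have hmod : ∀ k : ℤ, W (k % q) = W k := by
    intro k
    rw [Int.emod_def]
    have := hz k (-(k / q))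
    rw [← this]; congr 1; ring
  have huM : (p * u) ≡ 1 [ZMOD q] := hu
  refine Finset.sum_bij' (fun i _ => ((i * p : ℤ) % q).toNat) (fun k _ => ((k * u : ℤ) % q).toNat) ?_ ?_ ?_ ?_ ?_
  · intro i _
    have := Int.emod_lt_of_pos (i * p : ℤ) hq'
    have := Int.emod_nonneg (i * p : ℤ) hq'.ne'
    simp; omega
  · intro i _
    have := Int.emod_lt_of_pos (i * u : ℤ) hq'
    have := Int.emod_nonneg (i * u : ℤ) hq'.ne'
    simp; omega
  · intro i hi
    have h0 := Int.emod_nonneg (i * p : ℤ) hq'.ne'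
    have h1 : ((i * p : ℤ) % q) * u ≡ i [ZMOD q] := by
      calc ((i * p : ℤ) % q) * u ≡ (i * p) * u [ZMOD q] := (Int.mod_modEq _ _).mul_right _
        _ = i * (p * u) := by ring
        _ ≡ i * 1 [ZMOD q] := huM.mul_left _
        _ = i := by ring
    have h2 : (i : ℤ) % q = i := Int.emod_eq_of_lt (by positivity) (by simpa using hi)
    simp only [Int.toNat_of_nonneg h0]
    rw [h1, h2]; simp
  · intro i hi
    have h0 := Int.emod_nonneg (i * u : ℤ) hq'.ne'
    have h1 : ((i * u : ℤ) % q) * p ≡ i [ZMOD q] := by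
      calc ((i * u : ℤ) % q) * p ≡ (i * u) * p [ZMOD q] := (Int.mod_modEq _ _).mul_right _
        _ = i * (p * u) := by ring
        _ ≡ i * 1 [ZMOD q] := huM.mul_left _
        _ = i := by ring
    have h2 : (i : ℤ) % q = i := Int.emod_eq_of_lt (by positivity) (by simpa using hi)
    simp only [Int.toNat_of_nonneg h0]
    rw [h1, h2]; simp
  · intro i hi
    have h0 := Int.emod_nonneg (i * p : ℤ) hq'.ne'
    simp only [Int.toNat_of_nonneg h0, hmod]

lemma sdd_large_den (ρ : ℝ) (hirr : Irrational ρ) (N : ℕ) :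
    ∃ r : ℚ, N < r.den ∧ |ρ - r| < 1 / (r.den : ℝ) ^ 2 := by
  by_contra! hcon
  apply Real.infinite_rat_abs_sub_lt_one_div_den_sq_of_irrational hirr
  have hfin : (((Set.Icc (-⌈N * (|ρ| + 1)⌉) ⌈N * (|ρ| + 1)⌉) ×ˢ (Set.Icc 0 N) : Set (ℤ × ℕ))).Finite :=
    (Set.finite_Icc _ _).prod (Set.finite_Icc _ _)
  refine Set.Finite.of_finite_image (f := fun r : ℚ => (r.num, r.den)) (hfin.subset ?_) ?_
  · rintro _ ⟨r, hr, rfl⟩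
    simp only [Set.mem_ofPred_eq] at hr
    have hN : r.den ≤ N := by
      by_contra! h
      exact absurd hr (not_lt.2 (hcon r h))
    have hd : (1 : ℝ) ≤ r.den := by exact_mod_cast r.pos
    have hr1 : |ρ - r| < 1 := hr.trans_le (by
      rw [div_le_one (by positivity)]; nlinarith)
    have hr2 : |(r : ℝ)| ≤ |ρ| + 1 := by
      have := abs_sub_abs_le_abs_sub (r : ℝ) ρ
      rw [abs_sub_comm] at this; linarith
    have hnum : (r.num : ℝ) = r * r.den := by
      exact_mod_cast (Rat.mul_den_eq_num r).symm
    have h3 : |(r.num : ℝ)| ≤ N * (|ρ| + 1) := by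
      rw [hnum, abs_mul, mul_comm, abs_of_nonneg (by positivity : (0 : ℝ) ≤ r.den)]
      gcongr
    have h4 := abs_le.1 (h3.trans (Int.le_ceil _))
    simp only [Set.mem_prod, Set.mem_Icc]
    refine ⟨⟨by exact_mod_cast h4.1, by exact_mod_cast h4.2⟩, by simp, hN⟩
  · intro a _ b _ h
    simp only [Prod.mk.injEq] at h
    exact Rat.ext h.1 h.2

lemma sdd_iter_add_int (Φ : ℝ → ℝ) (hlift : ∀ x : ℝ, Φ (x + 1) = Φ x + 1) (x : ℝ) (m : ℤ) :
    Φ (x + m) = Φ x + m := by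
  induction m using Int.induction_on with
  | zero => simp
  | succ i ih => push_cast at ih ⊢; rw [← add_assoc, hlift, ih]; ring
  | pred i ih =>
    have := hlift (x + ((-i - 1 : ℤ) : ℝ))
    push_cast at ih this ⊢
    rw [show x + (-(i : ℝ) - 1) + 1 = x + -i by ring, ih] at this
    linarith

lemma sdd_koksma (Φ : ℝ → ℝ) (hmono : StrictMono Φ)
    (hlift : ∀ x : ℝ, Φ (x + 1) = Φ x + 1) (ρ : ℝ)
    (h : ℝ → ℝ) (hm : Monotone h) (hh1 : ∀ (x : ℝ) (m : ℤ), h (x + m) = h x + m)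
    (hsc : ∀ x, h (Φ x) = h x + ρ) (r : ℚ) (hr : |ρ - r| < 1 / (r.den : ℝ) ^ 2)
    (f : ℝ → ℝ) (hf : LipschitzWith 1 f) (x y : ℝ) :
    |∑ i ∈ Finset.range r.den, f (Φ (Φ^[i] x) - Φ^[i] x) -
      ∑ i ∈ Finset.range r.den, f (Φ (Φ^[i] y) - Φ^[i] y)| ≤ 10 := by
  obtain ⟨q, hqdef⟩ : ∃ q : ℕ, q = r.den := ⟨_, rfl⟩
  obtain ⟨p, hpdef⟩ : ∃ p : ℤ, p = r.num := ⟨_, rfl⟩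
  have hq : 0 < q := hqdef ▸ r.pos
  have hq' : (0 : ℤ) < q := by exact_mod_cast hq
  have hqR : (0 : ℝ) < q := by exact_mod_cast hq
  have hcop : IsCoprime p (q : ℤ) := by
    rw [hpdef, hqdef]; exact Rat.isCoprime_num_den r
  obtain ⟨u, v, huv⟩ := hcop
  have hu : (p * u) % q = 1 % q := by
    have : p * u = 1 + q * (-v) := by linarith
    rw [this, Int.add_mul_emod_self_left]
  have hrpq : (r : ℝ) = p / q := by rw [hpdef, hqdef]; exact_mod_cast (Rat.num_div_den r).symm
  rw [← hqdef] at hr ⊢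
  rw [hrpq] at hr
  let ix : ℤ → ℕ := fun k => ((k * u) % q).toNat
  let mx : ℤ → ℤ := fun k => (k - ix k * p) / q
  have hixc : ∀ k, (ix k : ℤ) = (k * u) % q := fun k =>
    Int.toNat_of_nonneg (Int.emod_nonneg _ hq'.ne')
  have hixlt : ∀ k, ix k < q := fun k => by
    have := Int.emod_lt_of_pos (k * u) hq'
    have := hixc k
    omega
  have huM : (p * u) ≡ 1 [ZMOD q] := hu
  have hmx : ∀ k, mx k * q = k - ix k * p := by
    intro k
    apply Int.ediv_mul_cancel
    apply Int.ModEq.dvd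
    rw [hixc]
    calc ((k * u : ℤ) % q) * p ≡ (k * u) * p [ZMOD q] := (Int.mod_modEq _ _).mul_right _
        _ = k * (p * u) := by ring
        _ ≡ k * 1 [ZMOD q] := huM.mul_left _
        _ = k := by ring
  have hixq : ∀ k, ix (k + q) = ix k := by
    intro k
    simp only [ix]
    rw [add_mul, Int.add_mul_emod_self_left]
  have hmxq : ∀ k, mx (k + q) = mx k + 1 := by
    intro k
    have h1 := hmx (k + q)
    have h2 := hmx k
    rw [hixq] at h1
    have : (mx (k + q)) * q = (mx k + 1) * q := by linarith
    exact mul_right_cancel₀ hq'.ne' this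
  have hixi : ∀ i : ℕ, i < q → ix (i * p) = i := by
    intro i hi
    have h1 : ((i : ℤ) * p) * u ≡ i [ZMOD q] := by
      calc ((i : ℤ) * p) * u = i * (p * u) := by ring
        _ ≡ i * 1 [ZMOD q] := huM.mul_left _
        _ = i := by ring
    have h2 : (i : ℤ) % q = i := Int.emod_eq_of_lt (by positivity) (by exact_mod_cast hi)
    have := hixc (i * p)
    rw [h1, h2] at this
    exact_mod_cast this
  let X : ℝ → ℤ → ℝ := fun x k => Φ^[ix k] x + mx k
  have hXq : ∀ x k, X x (k + q) = X x k + 1 := by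
    intro x k
    simp only [X, hixq, hmxq]; push_cast; ring
  have hsci : ∀ (n : ℕ) (x : ℝ), h (Φ^[n] x) = h x + n * ρ := by
    intro n
    induction n with
    | zero => simp
    | succ n ih => intro x; rw [Function.iterate_succ_apply', hsc, ih]; push_cast; ring
  have hXh : ∀ (x : ℝ) (k : ℤ), (k - 1 : ℝ) < (h (X x k) - h x) * q ∧ (h (X x k) - h x) * q < k + 1 := by
    intro x k
    have e : (h (X x k) - h x) * q = k + ix k * (ρ - p / q) * q := by
      simp only [X, hh1, hsci]
      have : (mx k : ℝ) * q = k - ix k * p := by exact_mod_cast hmx k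
      field_simp
      linarith
    have b : |ix k * (ρ - p / q) * q| < 1 := by
      rw [abs_mul, abs_mul, abs_of_nonneg (by positivity : (0 : ℝ) ≤ ix k), abs_of_pos hqR]
      have h1 : (ix k : ℝ) < q := by exact_mod_cast hixlt k
      have h2 : |ρ - p / q| * (q * q) < 1 := by
        rw [lt_div_iff₀ (by positivity)] at hr; nlinarith
      have h3 : (ix k : ℝ) * |ρ - p / q| * q ≤ q * |ρ - p / q| * q := by gcongr
      linarith
    have := abs_lt.1 b
    rw [e]; constructor <;> linarith
  have hlt : ∀ a b, h a < h b → a < b := fun a b hab => by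
    by_contra! hc
    exact absurd (hm hc) (not_le.2 hab)
  obtain ⟨k0, hk0⟩ : ∃ k0 : ℤ, k0 = ⌊(h y - h x) * q⌋ := ⟨_, rfl⟩
  have hk1 : (k0 : ℝ) ≤ (h y - h x) * q := hk0 ▸ Int.floor_le _
  have hk2 : (h y - h x) * q < k0 + 1 := hk0 ▸ Int.lt_floor_add_one _
  have lt' : ∀ a b, (h a - h x) * q < (h b - h x) * q → a < b := fun a b hab => by
    apply hlt
    have := lt_of_mul_lt_mul_right hab hqR.le
    linarith
  have A1 : ∀ k : ℤ, X x (k + (k0 - 2)) < X y k := fun k => by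
    apply lt'
    have := (hXh x (k + (k0 - 2))).2
    have := (hXh y k).1
    push_cast at *
    nlinarith
  have A2 : ∀ k : ℤ, X y k < X x (k + (k0 - 2 + 5)) := fun k => by
    apply lt'
    have := (hXh x (k + (k0 - 2 + 5))).1
    have := (hXh y k).2
    push_cast at *
    nlinarith
  have A3 : ∀ k : ℤ, X x (k + (k0 - 2)) < X x (k + k0) := fun k => by
    apply lt'
    have := (hXh x (k + (k0 - 2))).2
    have := (hXh x (k + k0)).1
    push_cast at *
    nlinarith
  have A4 : ∀ k : ℤ, X x (k + k0) < X x (k + (k0 - 2 + 5)) := fun k => by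
    apply lt'
    have := (hXh x (k + (k0 - 2 + 5))).1
    have := (hXh x (k + k0)).2
    push_cast at *
    nlinarith
  let g : ℝ → ℝ := fun z => f (Φ z - z)
  have hgint : ∀ (z : ℝ) (m : ℤ), g (z + m) = g z := by
    intro z m
    simp only [g]; rw [sdd_iter_add_int Φ hlift]; congr 1; ring
  have hgX : ∀ z k, g (X z (k + q)) = g (X z k) := by
    intro z k
    rw [hXq]; simpa using hgint (X z k) 1
  have hsumX : ∀ z, ∑ i ∈ Finset.range q, g (Φ^[i] z) = ∑ k ∈ Finset.range q, g (X z k) := by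
    intro z
    rw [← sdd_emod_sum q hq (fun k => g (X z k)) (hgX z) p u hu]
    refine Finset.sum_congr rfl fun i hi => ?_
    simp only [X]
    rw [hgint, hixi i (by simpa using hi)]
  change |∑ i ∈ Finset.range q, g (Φ^[i] x) - ∑ i ∈ Finset.range q, g (Φ^[i] y)| ≤ 10
  rw [hsumX, hsumX, ← sdd_periodic_sum q (fun k => g (X x k)) (hgX x) k0, ← Finset.sum_sub_distrib]
  have hstep : ∀ W : ℤ → ℝ, (∀ k, W (k + q) = W k + 1) →
      ∑ k ∈ Finset.range q, (W (k + (k0 - 2 + 5)) - W (k + (k0 - 2))) = 5 := by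
    intro W hW
    have s := sdd_shift_sum q W 1 hW
    have e : k0 - 2 + 5 = k0 - 2 + 1 + 1 + 1 + 1 + 1 := by ring
    rw [Finset.sum_sub_distrib, e, s, s, s, s, s]; ring
  have hgl : ∀ a b c d : ℝ, c < a → a < d → c < b → b < d →
      |g a - g b| ≤ (Φ d - Φ c) + (d - c) := by
    intro a b c d h1 h2 h3 h4
    have := hf.dist_le_mul (Φ a - a) (Φ b - b)
    rw [Real.dist_eq, Real.dist_eq] at this
    simp only [NNReal.coe_one, one_mul] at this
    refine this.trans ?_
    have := hmono h1
    have := hmono h2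
    have := hmono h3
    have := hmono h4
    rw [abs_le]; constructor <;> linarith
  calc _ ≤ ∑ k ∈ Finset.range q, |g (X x (k + k0)) - g (X y k)| := Finset.abs_sum_le_sum_abs _ _
    _ ≤ ∑ k ∈ Finset.range q, ((Φ (X x (k + (k0 - 2 + 5))) - Φ (X x (k + (k0 - 2)))) +
        (X x (k + (k0 - 2 + 5)) - X x (k + (k0 - 2)))) :=
      Finset.sum_le_sum fun k _ => hgl _ _ _ _ (A3 k) (A4 k) (A1 k) (A2 k)
    _ = 10 := by
      rw [Finset.sum_add_distrib, hstep (fun k => Φ (X x k)) (fun k => by rw [hXq, hlift]),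
        hstep (X x) (hXq x)]
      norm_num

lemma sdd_semiconj (Φ : ℝ → ℝ) (hmono : StrictMono Φ)
    (hbij : Function.Bijective Φ) (hlift : ∀ x : ℝ, Φ (x + 1) = Φ x + 1)
    (ρ : ℝ) (hrot : ∀ x : ℝ, Tendsto (fun n : ℕ => Φ^[n] x / n) atTop (nhds ρ)) :
    ∃ h : ℝ → ℝ, Monotone h ∧ (∀ (x : ℝ) (m : ℤ), h (x + m) = h x + m) ∧
      ∀ x, h (Φ x) = h x + ρ := by
  let F : CircleDeg1Lift := ⟨⟨Φ, hmono.monotone⟩, hlift⟩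
  let T := CircleDeg1Lift.translate (Multiplicative.ofAdd ρ)
  have hF : F.translationNumber = ρ := F.translationNumber_eq_of_tendsto₀ (hrot 0)
  obtain ⟨h, hh⟩ := CircleDeg1Lift.semiconj_of_bijective_of_translationNumber_eq
    (f₁ := F) (f₂ := T) hbij (CircleDeg1Lift.isUnit_iff_bijective.1 T.isUnit)
    (by rw [hF]; exact (CircleDeg1Lift.translationNumber_translate ρ).symm)
  refine ⟨h, h.monotone, fun x m => h.map_add_int x m, fun x => ?_⟩
  have := hh x
  change h (Φ x) = T (h x) at this
  rw [this]; simp [T, add_comm]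

lemma sdd_block (T : ℝ → ℝ) (s : ℝ → ℝ) (q : ℕ) (hq : 0 < q) (I B e : ℝ) (he : 0 ≤ e)
    (hB : ∀ u, |s u - I| ≤ B)
    (hblock : ∀ u, |∑ i ∈ Finset.range q, s (T^[i] u) - q * I| ≤ q * e) (n : ℕ) :
    ∀ u, |∑ i ∈ Finset.range n, s (T^[i] u) - n * I| ≤ n * e + q * B := by
  have hB0 : 0 ≤ B := (abs_nonneg _).trans (hB 0)
  induction n using Nat.strong_induction_on with
  | _ n ih =>
    intro u
    rcases lt_or_ge n q with hn | hn
    · have h1 : ∑ i ∈ Finset.range n, s (T^[i] u) - n * I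
          = ∑ i ∈ Finset.range n, (s (T^[i] u) - I) := by
        simp [Finset.sum_sub_distrib]
      rw [h1]
      have h2 : |∑ i ∈ Finset.range n, (s (T^[i] u) - I)| ≤ ∑ i ∈ Finset.range n, B :=
        (Finset.abs_sum_le_sum_abs _ _).trans (Finset.sum_le_sum fun i _ => hB _)
      simp only [Finset.sum_const, Finset.card_range, nsmul_eq_mul] at h2
      have h3 : (n : ℝ) * B ≤ q * B := by gcongr
      have h4 : 0 ≤ (n : ℝ) * e := by positivity
      linarith
    · obtain ⟨m, rfl⟩ := Nat.exists_eq_add_of_le hn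
      rw [Finset.sum_range_add]
      have h1 := ih m (by omega) (T^[q] u)
      have h2 := hblock u
      have h3 : ∀ i, T^[q + i] u = T^[i] (T^[q] u) := fun i => by
        rw [← Function.iterate_add_apply, add_comm]
      simp only [h3]
      rw [abs_le] at *
      push_cast
      constructor <;> linarith [h1.1, h1.2, h2.1, h2.2]

lemma sdd_unif (Φ : ℝ → ℝ) (hcont : Continuous Φ) (hlift : ∀ x : ℝ, Φ (x + 1) = Φ x + 1) :
    UniformContinuous Φ := by
  have hp : Function.Periodic (fun x => Φ x - x) 1 := fun x => by simp [hlift]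
  have h1 : UniformContinuous (fun x => Φ x - x) := by
    have hc : Continuous (fun x => Φ x - x) := by fun_prop
    rw [Metric.uniformContinuous_iff]
    intro ε hε
    have hcomp := (isCompact_Icc (a := (-1 : ℝ)) (b := 2)).uniformContinuousOn_of_continuous
      hc.continuousOn
    rw [Metric.uniformContinuousOn_iff] at hcomp
    obtain ⟨δ, hδ, H⟩ := hcomp ε hε
    refine ⟨min δ 1, by positivity, fun a b hab => ?_⟩
    have hab1 : |a - b| < δ := (Real.dist_eq a b ▸ hab).trans_le (min_le_left _ _)
    have hab2 := abs_lt.1 ((Real.dist_eq a b ▸ hab).trans_le (min_le_right _ _))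
    have f1 := Int.floor_le a
    have f2 := Int.lt_floor_add_one a
    have := H (a - ⌊a⌋) ⟨by linarith, by linarith⟩ (b - ⌊a⌋) ⟨by linarith, by linarith⟩
      (by rw [Real.dist_eq, sub_sub_sub_cancel_right]; exact hab1)
    have e : ∀ z : ℝ, Φ (z - ⌊a⌋) - (z - ⌊a⌋) = Φ z - z := fun z => by
      simpa using hp.sub_zsmul_eq (x := z) ⌊a⌋
    simpa only [e] using this
  have := h1.add uniformContinuous_id
  simpa using this

lemma sdd_close (Φ : ℝ → ℝ) (hu : UniformContinuous Φ) (n : ℕ) (η : ℝ) (hη : 0 < η) :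
    ∃ δ : ℝ, 0 < δ ∧ ∀ Φt : ℝ → ℝ, (∀ x, |Φ x - Φt x| < δ) →
      ∀ i ≤ n, ∀ u, |Φ^[i] u - Φt^[i] u| < η := by
  induction n generalizing η with
  | zero =>
    refine ⟨1, one_pos, fun Φt _ i hi u => ?_⟩
    obtain rfl : i = 0 := by omega
    simpa using hη
  | succ n ih =>
    obtain ⟨θ, hθ, H⟩ := Metric.uniformContinuous_iff.1 hu (η / 2) (by positivity)
    obtain ⟨δ, hδ, K⟩ := ih (min θ η) (by positivity)
    refine ⟨min δ (η / 2), by positivity, fun Φt ht i hi u => ?_⟩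
    have K' := K Φt (fun x => (ht x).trans_le (min_le_left _ _))
    rcases Nat.lt_or_ge n i with h | h
    · obtain rfl : i = n + 1 := by omega
      rw [Function.iterate_succ_apply', Function.iterate_succ_apply']
      have a1 := H (a := Φ^[n] u) (b := Φt^[n] u) (by
        rw [Real.dist_eq]; exact (K' n le_rfl u).trans_le (min_le_left _ _))
      rw [Real.dist_eq] at a1
      have a2 := (ht (Φt^[n] u)).trans_le (min_le_right _ _)
      rw [abs_lt] at *
      constructor <;> linarith [a1.1, a1.2, a2.1, a2.2]
    · exact (K' i h u).trans_le (min_le_right _ _)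


/-- Approximation of the displacement distribution by sample
displacements of nearby homeomorphisms: for each `ε > 0` there is `δ > 0` such that for
every lift `Φ̃` of a circle homeomorphism uniformly `δ`-close to `Φ`, every starting
point `x₀` and every `1`-Lipschitz `f`, the Birkhoff averages of `f` over the sample
displacements of `Φ̃` stay `ε`-close (in the limsup sense) to `∫ f ∘ ψ̄ dμ`. -/
theorem sample_displacement_distribution_approximation
    (Φ : ℝ → ℝ) (hcont : Continuous Φ) (hmono : StrictMono Φ)
    (hbij : Function.Bijective Φ) (hlift : ∀ x : ℝ, Φ (x + 1) = Φ x + 1)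
    (ρ : ℝ) (hirr : Irrational ρ)
    (hrot : ∀ x : ℝ, Tendsto (fun n : ℕ => Φ^[n] x / n) atTop (nhds ρ))
    (φ : AddCircle (1 : ℝ) → AddCircle (1 : ℝ))
    (hφ : ∀ x : ℝ, φ (x : AddCircle (1 : ℝ)) = ((Φ x : ℝ) : AddCircle (1 : ℝ)))
    (μ : Measure (AddCircle (1 : ℝ))) (hprob : IsProbabilityMeasure μ)
    (hinv : Measure.map φ μ = μ)
    (ψb : AddCircle (1 : ℝ) → ℝ) (hψcont : Continuous ψb)
    (hψ : ∀ x : ℝ, ψb (x : AddCircle (1 : ℝ)) = Φ x - x)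
    (ε : ℝ) (hε : 0 < ε) :
    ∃ δ : ℝ, 0 < δ ∧
      ∀ (Φt : ℝ → ℝ), Continuous Φt → StrictMono Φt → Function.Bijective Φt →
        (∀ x : ℝ, Φt (x + 1) = Φt x + 1) →
        (∀ x : ℝ, |Φ x - Φt x| < δ) →
        ∀ x₀ : ℝ, ∀ f : ℝ → ℝ, LipschitzWith 1 f →
          Filter.limsup
            (fun n : ℕ =>
              |(∑ i ∈ Finset.range n, f (Φt^[i + 1] x₀ - Φt^[i] x₀)) / n -
                ∫ z, f (ψb z) ∂μ|) atTop < ε := by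
  obtain ⟨h, hm, hh1, hsc⟩ := sdd_semiconj Φ hmono hbij hlift ρ hrot
  obtain ⟨N, hN⟩ := exists_nat_gt (40 / ε)
  obtain ⟨r, hNr, hr⟩ := sdd_large_den ρ hirr N
  have hkok := sdd_koksma Φ hmono hlift ρ h hm hh1 hsc r hr
  obtain ⟨q, hqdef⟩ : ∃ q : ℕ, q = r.den := ⟨_, rfl⟩
  rw [← hqdef] at hkok hNr
  have hq : 0 < q := by omega
  have hqR : (0 : ℝ) < q := by exact_mod_cast hq
  have hqε : 10 < q * (ε / 4) := by
    have : (N : ℝ) < q := by exact_mod_cast hNr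
    have := hN.trans this
    rw [div_lt_iff₀ hε] at this
    linarith
  have hφc : Continuous φ := by
    have : Continuous (φ ∘ ((↑) : ℝ → AddCircle (1 : ℝ))) := by
      have e : φ ∘ ((↑) : ℝ → AddCircle (1 : ℝ)) = fun x => ((Φ x : ℝ) : AddCircle (1 : ℝ)) :=
        funext hφ
      rw [e]
      exact (AddCircle.continuous_mk' (1 : ℝ)).comp hcont
    exact (QuotientAddGroup.isQuotientMap_mk _).continuous_iff.2 this
  have hmp : MeasurePreserving φ μ μ := ⟨hφc.measurable, hinv⟩
  have hφi : ∀ (i : ℕ) (x : ℝ), φ^[i] (x : AddCircle (1 : ℝ)) = ((Φ^[i] x : ℝ) : AddCircle (1 : ℝ)) := by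
    intro i
    induction i with
    | zero => simp
    | succ i ih => intro x; rw [Function.iterate_succ_apply', Function.iterate_succ_apply', ih, hφ]
  -- Denjoy-Koksma against the invariant measure
  have hDK : ∀ f : ℝ → ℝ, LipschitzWith 1 f → ∀ x,
      |∑ i ∈ Finset.range q, f (Φ (Φ^[i] x) - Φ^[i] x) - q * ∫ z, f (ψb z) ∂μ| ≤ 10 := by
    intro f hf x
    have hci : ∀ i : ℕ, Continuous fun z => f (ψb (φ^[i] z)) := fun i =>
      hf.continuous.comp (hψcont.comp (hφc.iterate i))
    have hIntegr : ∀ i : ℕ, Integrable (fun z => f (ψb (φ^[i] z))) μ := fun i =>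
      (hci i).integrable_of_hasCompactSupport (HasCompactSupport.of_compactSpace _)
    have hI : ∀ i : ℕ, ∫ z, f (ψb (φ^[i] z)) ∂μ = ∫ z, f (ψb z) ∂μ := by
      intro i
      have hi := hmp.iterate i
      have := integral_map (μ := μ) (φ := φ^[i]) hi.measurable.aemeasurable
        (f := fun z => f (ψb z)) (hf.continuous.comp hψcont).aestronglyMeasurable
      rw [hi.map_eq] at this
      exact this.symm
    obtain ⟨S, hS⟩ : ∃ S, S = ∑ i ∈ Finset.range q, f (Φ (Φ^[i] x) - Φ^[i] x) := ⟨_, rfl⟩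
    rw [← hS]
    have e : S - q * ∫ z, f (ψb z) ∂μ = ∫ z, (S - ∑ i ∈ Finset.range q, f (ψb (φ^[i] z))) ∂μ := by
      rw [integral_sub (integrable_const _) (integrable_finsetSum _ fun i _ => hIntegr i),
        integral_finsetSum _ fun i _ => hIntegr i]
      simp [hI]
    rw [e, ← Real.norm_eq_abs]
    refine (norm_integral_le_of_norm_le_const (C := 10) (Eventually.of_forall fun z => ?_)).trans (by simp)
    obtain ⟨y, rfl⟩ := QuotientAddGroup.mk_surjective z
    have := hkok f hf x y
    rw [← hS] at this
    have e2 : ∀ i, f (ψb (φ^[i] (y : AddCircle (1 : ℝ)))) = f (Φ (Φ^[i] y) - Φ^[i] y) := fun i => by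
      rw [hφi, hψ]
    rw [Real.norm_eq_abs]
    simpa only [e2] using this
  obtain ⟨δ, hδ, hclose⟩ := sdd_close Φ (sdd_unif Φ hcont hlift) q (ε / 8) (by positivity)
  refine ⟨δ, hδ, fun Φt htc htm htb htl htd x₀ f hf => ?_⟩
  have hcl := hclose Φt htd
  obtain ⟨I, hIdef⟩ : ∃ I, I = ∫ z, f (ψb z) ∂μ := ⟨_, rfl⟩
  rw [← hIdef]
  let s : ℝ → ℝ := fun u => f (Φt u - u)
  have hsc : Continuous s := hf.continuous.comp (htc.sub continuous_id)
  have hsp : Function.Periodic s 1 := fun u => by simp [s, htl]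
  obtain ⟨B, hB⟩ : ∃ B, ∀ u, |s u - I| ≤ B := by
    obtain ⟨C, hC⟩ := (hsp.isBounded_of_continuous one_ne_zero hsc).exists_norm_le
    refine ⟨C + |I|, fun u => ?_⟩
    have := hC (s u) ⟨u, rfl⟩
    rw [Real.norm_eq_abs] at this
    exact (abs_sub _ _).trans (by linarith)
  have hblock : ∀ u, |∑ i ∈ Finset.range q, s (Φt^[i] u) - q * I| ≤ q * (ε / 2) := by
    intro u
    have h1 := hDK f hf u
    rw [← hIdef] at h1
    have h2 : |∑ i ∈ Finset.range q, s (Φt^[i] u) - ∑ i ∈ Finset.range q, f (Φ (Φ^[i] u) - Φ^[i] u)|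
        ≤ q * (ε / 4) := by
      rw [← Finset.sum_sub_distrib]
      refine (Finset.abs_sum_le_sum_abs _ _).trans ?_
      refine (Finset.sum_le_sum (g := fun _ => ε / 4) fun i hi => ?_).trans (by simp)
      have hi' : i < q := by simpa using hi
      have a1 := hcl i hi'.le u
      have a2 := hcl (i + 1) hi' u
      rw [Function.iterate_succ_apply', Function.iterate_succ_apply'] at a2
      have a3 := hf.dist_le_mul (Φt (Φt^[i] u) - Φt^[i] u) (Φ (Φ^[i] u) - Φ^[i] u)
      rw [Real.dist_eq, Real.dist_eq] at a3
      simp only [NNReal.coe_one, one_mul] at a3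
      refine a3.trans ?_
      rw [abs_lt] at a1 a2
      rw [abs_le]
      constructor <;> linarith [a1.1, a1.2, a2.1, a2.2]
    rw [abs_le] at *
    constructor <;> linarith [h1.1, h1.2, h2.1, h2.2]
  have hall := sdd_block Φt s q hq I B (ε / 2) (by positivity) hB hblock
  have hev : ∀ᶠ n : ℕ in atTop,
      |(∑ i ∈ Finset.range n, f (Φt^[i + 1] x₀ - Φt^[i] x₀)) / n - I| ≤ 3 * ε / 4 := by
    obtain ⟨M, hM⟩ := exists_nat_gt (q * B / (ε / 4))
    filter_upwards [eventually_ge_atTop M, eventually_gt_atTop 0] with n hn hn0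
    have hnR : (0 : ℝ) < n := by exact_mod_cast hn0
    have h1 := hall n x₀
    have h2 : ∀ i, f (Φt^[i + 1] x₀ - Φt^[i] x₀) = s (Φt^[i] x₀) := fun i => by
      simp only [s, Function.iterate_succ_apply']
    simp only [h2]
    have h3 : (∑ i ∈ Finset.range n, s (Φt^[i] x₀)) / n - I
        = (∑ i ∈ Finset.range n, s (Φt^[i] x₀) - n * I) / n := by
      field_simp
    rw [h3, abs_div, abs_of_pos hnR, div_le_iff₀ hnR]
    have h4 : (M : ℝ) ≤ n := by exact_mod_cast hn
    rw [div_lt_iff₀ (by positivity)] at hM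
    nlinarith
  refine (limsup_le_of_le ?_ hev).trans_lt (by linarith)
  exact Filter.IsCoboundedUnder.of_frequently_ge (a := 0)
    (Frequently.of_forall fun n => abs_nonneg _)
end

section
/- Almost strong recurrence of the displacement sequence: Let Φ be a lift of an orientation-preserving circle homeomorphism with irrational rotation number, let φ be the induced homeomorphism of ℝ/ℤ, and let x ∈ ℝ be a point whose projection π(x) belongs to a minimal set Δ of φ (if φ is minimal one may take Δ = ℝ/ℤ and x arbitrary). Then for every ε > 0 there exists N ∈ ℕ such that for every n ≥ 1 and every k ≥ 0 there exists i ∈ {0, 1, …, N} with |η_{n+k+i}(x) − η_n(x)| < ε, where η_m(x) = Φ^m(x) − Φ^{m−1}(x). -/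
open Filter Set

/-- Almost strong recurrence of the displacement sequence: for a lift
`Φ` of a circle homeomorphism with irrational rotation number and a point `x` projecting
into a minimal set `Δ` of the induced homeomorphism `φ`, the displacement sequence
`η m x = Φ^[m] x - Φ^[m-1] x` is almost strongly recurrent. -/
theorem displacement_almost_strongly_recurrent
    (Φ : ℝ → ℝ) (hcont : Continuous Φ) (hmono : StrictMono Φ)
    (hbij : Function.Bijective Φ) (hlift : ∀ x : ℝ, Φ (x + 1) = Φ x + 1)
    (ρ : ℝ) (hirr : Irrational ρ)
    (hrot : ∀ x : ℝ, Tendsto (fun n : ℕ => Φ^[n] x / n) atTop (nhds ρ))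
    (φ : AddCircle (1 : ℝ) → AddCircle (1 : ℝ))
    (hφ : ∀ x : ℝ, φ (x : AddCircle (1 : ℝ)) = ((Φ x : ℝ) : AddCircle (1 : ℝ)))
    (Δ : Set (AddCircle (1 : ℝ))) (hΔne : Δ.Nonempty) (hΔclosed : IsClosed Δ)
    (hΔinv : φ '' Δ = Δ)
    (hΔmin : ∀ u ∈ Δ, Δ ⊆ closure (Set.range fun n : ℕ => φ^[n] u))
    (x : ℝ) (hx : (x : AddCircle (1 : ℝ)) ∈ Δ)
    (ε : ℝ) (hε : 0 < ε) :
    ∃ N : ℕ, ∀ n : ℕ, 1 ≤ n → ∀ k : ℕ, ∃ i : ℕ, i ≤ N ∧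
      |(Φ^[n + k + i] x - Φ^[n + k + i - 1] x) - (Φ^[n] x - Φ^[n - 1] x)| < ε := by
  have hper : Function.Periodic (fun y : ℝ => Φ y - y) 1 := by
    intro y
    simp only [hlift]
    ring
  obtain ⟨d, hd⟩ : ∃ d : AddCircle (1 : ℝ) → ℝ, ∀ y : ℝ, d (y : AddCircle (1 : ℝ)) = Φ y - y :=
    ⟨hper.lift, fun y => hper.lift_coe y⟩
  have hq : Topology.IsQuotientMap (fun y : ℝ => (y : AddCircle (1 : ℝ))) :=
    QuotientAddGroup.isQuotientMap_mk _
  have hdc : Continuous d := by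
    rw [hq.continuous_iff]
    have : d ∘ (fun y : ℝ => (y : AddCircle (1 : ℝ))) = fun y => Φ y - y := funext hd
    rw [this]
    fun_prop
  have hφc : Continuous φ := by
    rw [hq.continuous_iff]
    have : φ ∘ (fun y : ℝ => (y : AddCircle (1 : ℝ)))
        = (fun y : ℝ => (y : AddCircle (1 : ℝ))) ∘ Φ := funext hφ
    rw [this]
    exact hq.continuous.comp hcont
  have hit : ∀ n : ℕ, φ^[n] (x : AddCircle (1 : ℝ)) = ((Φ^[n] x : ℝ) : AddCircle (1 : ℝ)) := by
    intro n
    induction n with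
    | zero => rfl
    | succ n ih => rw [Function.iterate_succ_apply', Function.iterate_succ_apply', ih, hφ]
  have hmem : ∀ n : ℕ, φ^[n] (x : AddCircle (1 : ℝ)) ∈ Δ := by
    intro n
    induction n with
    | zero => exact hx
    | succ n ih =>
      rw [Function.iterate_succ_apply', ← hΔinv]
      exact mem_image_of_mem φ ih
  have hdn : ∀ n : ℕ, d (φ^[n] (x : AddCircle (1 : ℝ))) = Φ^[n + 1] x - Φ^[n] x := by
    intro n
    rw [hit, hd, Function.iterate_succ_apply']
  let U : ℕ → Set (AddCircle (1 : ℝ) × AddCircle (1 : ℝ)) :=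
    fun i => {p | |d (φ^[i] p.1) - d p.2| < ε}
  have hUo : ∀ i, IsOpen (U i) := by
    intro i
    have h1 : Continuous (φ^[i]) := hφc.iterate i
    exact isOpen_lt (by fun_prop) continuous_const
  have hK : IsCompact (Δ ×ˢ Δ) := hΔclosed.isCompact.prod hΔclosed.isCompact
  have hcov : Δ ×ˢ Δ ⊆ ⋃ i, U i := by
    rintro ⟨u, v⟩ ⟨hu, hv⟩
    have hcl := hΔmin u hu hv
    have hO : IsOpen {w | |d w - d v| < ε} := isOpen_lt (by fun_prop) continuous_const
    obtain ⟨w, hw, ⟨i, rfl⟩⟩ := mem_closure_iff.1 hcl _ hO (by simpa using hε)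
    exact mem_iUnion.2 ⟨i, hw⟩
  obtain ⟨t, ht⟩ := hK.elim_finite_subcover U hUo hcov
  refine ⟨t.sup id, fun n hn k => ?_⟩
  obtain ⟨m, rfl⟩ : ∃ m, n = m + 1 := ⟨n - 1, by omega⟩
  have hp := ht (show (φ^[m + k] (x : AddCircle (1 : ℝ)), φ^[m] (x : AddCircle (1 : ℝ)))
    ∈ Δ ×ˢ Δ from ⟨hmem _, hmem _⟩)
  simp only [mem_iUnion] at hp
  obtain ⟨i, hi, hlt⟩ := hp
  refine ⟨i, Finset.le_sup (f := id) hi, ?_⟩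
  change |d (φ^[i] (φ^[m + k] (x : AddCircle (1 : ℝ)))) - d (φ^[m] (x : AddCircle (1 : ℝ)))| < ε
    at hlt
  rw [← Function.iterate_add_apply, hdn, hdn] at hlt
  have e1 : m + 1 + k + i = i + (m + k) + 1 := by omega
  rw [e1]
  simpa using hlt
end

section
/- Uniform relative density of return times on a minimal compact system: Let (X, d) be a compact metric space and T : X → X a continuous map such that the forward orbit of every point is dense in X (i.e. X is a minimal set for T). Then for every x ∈ X and every ε > 0 there exists N ∈ ℕ such that for every n ≥ 0 and every k ≥ 0 there exists i ∈ {1, 2, …, N} with d(T^{n+k+i}(x), T^{n}(x)) < ε; that is, the set of return times of the orbit of x to the ε-neighbourhood of any point T^n(x) of the orbit is relatively dense in ℕ with gaps bounded uniformly over n. -/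
/-- Uniform relative density of return times on a minimal compact
system: for a continuous map `T` of a compact metric space all of whose forward orbits
are dense, for every `x` and `ε > 0` there is `N` such that the orbit of `x` returns
within `ε` of any orbit point `T^[n] x` after at most `N` further steps, uniformly in
the position `n` along the orbit and in the waiting time `k`. -/
theorem uniform_return_times_minimal
    {X : Type*} [MetricSpace X] [CompactSpace X]
    (T : X → X) (hT : Continuous T)
    (hmin : ∀ x : X, Dense (Set.range fun n : ℕ => T^[n] x))
    (x : X) (ε : ℝ) (hε : 0 < ε) :
    ∃ N : ℕ, ∀ n : ℕ, ∀ k : ℕ, ∃ i : ℕ, 1 ≤ i ∧ i ≤ N ∧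
      dist (T^[n + k + i] x) (T^[n] x) < ε := by
  have hcov : (Set.univ : Set (X × X)) ⊆
      ⋃ m : ℕ, {p : X × X | dist (T^[m + 1] p.1) p.2 < ε} := by
    rintro ⟨y, z⟩ -
    obtain ⟨w, ⟨m, rfl⟩, hm⟩ := (hmin (T y)).exists_dist_lt z hε
    refine Set.mem_iUnion.2 ⟨m, ?_⟩
    rw [dist_comm] at hm
    simpa [Function.iterate_succ_apply] using hm
  obtain ⟨t, ht⟩ := isCompact_univ.elim_finite_subcover _
    (fun m => isOpen_lt (((hT.iterate (m + 1)).comp continuous_fst).dist continuous_snd)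
      continuous_const) hcov
  refine ⟨t.sup id + 1, fun n k => ?_⟩
  have h := ht (Set.mem_univ (T^[n + k] x, T^[n] x))
  simp only [Set.mem_iUnion] at h
  obtain ⟨m, hmt, hm⟩ := h
  refine ⟨m + 1, by omega, Nat.succ_le_succ (Finset.le_sup (f := id) hmt), ?_⟩
  rw [add_comm (n + k), Function.iterate_add_apply]
  exact hm
end

section
/- Uniform convergence of displacement distributions on intervals: Let Φ_n be lifts of orientation-preserving circle homeomorphisms with irrational rotation numbers such that sup_{x∈ℝ} |Φ_n(x) − Φ(x)| → 0, where Φ is a continuously differentiable lift of an orientation-preserving circle diffeomorphism with irrational rotation number ρ = ρ(Φ). Assume there is a lift Γ of a conjugacy of Φ with the translation by ρ which is a C¹-diffeomorphism of ℝ, and that the set C = {x ∈ [0,1] : Φ′(x) = 1} has Lebesgue measure zero. Let μ_n and μ be the unique invariant Borel probability measures of the induced homeomorphisms φ_n and φ, with displacement distributions μ_Ψ^{(n)} = (ψ̄_n)_*μ_n and μ_Ψ = ψ̄_*μ. Then sup { |μ_Ψ^{(n)}(I) − μ_Ψ(I)| : I ⊆ ℝ an interval (open, closed, or half-open) } → 0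 as n → ∞. -/
open Filter Set MeasureTheory


lemma aux_polya (νs : ℕ → ProbabilityMeasure ℝ) (ν : ProbabilityMeasure ℝ)
    (h : Tendsto νs atTop (nhds ν)) (hat : ∀ c, (ν : Measure ℝ) {c} = 0) (ε : ℝ) (hε : 0 < ε) :
    ∃ N, ∀ n, N ≤ n → ∀ L : Set ℝ, IsLowerSet L →
      |(νs n : Measure ℝ).real L - (ν : Measure ℝ).real L| < ε := by
  have hF : Continuous (ProbabilityTheory.cdf (ν : Measure ℝ)) := by
    rw [continuous_iff_continuousAt]
    intro a
    rw [(ProbabilityTheory.monotone_cdf _).continuousAt_iff_leftLim_eq_rightLim,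
      StieltjesFunction.rightLim_eq]
    apply le_antisymm
    · exact (ProbabilityTheory.monotone_cdf _).leftLim_le le_rfl
    · have := StieltjesFunction.measure_singleton (ProbabilityTheory.cdf (ν : Measure ℝ)) a
      rw [ProbabilityTheory.measure_cdf, hat, eq_comm, ENNReal.ofReal_eq_zero] at this
      linarith
  obtain ⟨m, hm⟩ := exists_nat_gt (4 / ε)
  have hm0 : (0 : ℝ) < m := lt_trans (by positivity) hm
  have hm4 : 1 / (m : ℝ) < ε / 4 := by
    rw [div_lt_iff₀ hε] at hm
    rw [div_lt_iff₀ hm0]; linarith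
  have ht : ∀ j : ℕ, ∃ t : ℝ, 0 < j → j < m → (ν : Measure ℝ).real (Iic t) = j / m := by
    intro j
    by_cases hj : 0 < j ∧ j < m
    · have h1 : (0 : ℝ) < (j : ℝ) / m := div_pos (by exact_mod_cast hj.1) hm0
      have h2 : (j : ℝ) / m < 1 := by rw [div_lt_one hm0]; exact_mod_cast hj.2
      obtain ⟨t, ht⟩ := mem_range_of_exists_le_of_exists_ge hF (c := (j : ℝ) / m)
        (((ProbabilityTheory.tendsto_cdf_atBot _).eventually_le_const h1).exists)
        (((ProbabilityTheory.tendsto_cdf_atTop _).eventually_const_le h2).exists)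
      refine ⟨t, fun _ _ => ?_⟩
      rw [← ProbabilityTheory.cdf_eq_real, ht]
    · exact ⟨0, fun a b => absurd ⟨a, b⟩ hj⟩
  choose t ht using ht
  have hev : ∀ᶠ n in atTop, ∀ j ∈ Finset.range m,
      |(νs n : Measure ℝ).real (Iic (t j)) - (ν : Measure ℝ).real (Iic (t j))| < ε / 4 := by
    rw [Filter.eventually_all_finset]
    intro j _
    have h1 := ProbabilityMeasure.tendsto_measure_of_null_frontier_of_tendsto' h
      (E := Iic (t j)) (by rw [frontier_Iic]; exact hat _)
    have h2 := (ENNReal.tendsto_toReal (measure_ne_top _ _)).comp h1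
    have := Metric.tendsto_nhds.1 h2 (ε / 4) (by positivity)
    filter_upwards [this] with n hn
    simpa [Real.dist_eq, Measure.real] using hn
  obtain ⟨N, hN⟩ := eventually_atTop.1 hev
  refine ⟨N, fun n hn L hL => ?_⟩
  have hb := hN n hn
  set v := (ν : Measure ℝ).real L with hv
  set w := (νs n : Measure ℝ).real L with hw
  have v0 : 0 ≤ v := measureReal_nonneg
  have w0 : 0 ≤ w := measureReal_nonneg
  have v1 : v ≤ 1 := measureReal_le_one
  have w1 : w ≤ 1 := measureReal_le_one
  have hcase : ∀ s : ℝ, Iic s ⊆ L ∨ L ⊆ Iic s := by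
    intro s
    by_cases hs : s ∈ L
    · exact Or.inl fun y hy => hL hy hs
    · right
      intro y hy
      by_contra hys
      exact hs (hL (le_of_lt (not_le.1 hys)) hy)
  have hmm : (1 / (m : ℝ)) * m = 1 := by field_simp
  rw [abs_lt]
  constructor
  · by_cases hsm : v ≤ 2 / m
    · have : 2 / (m : ℝ) = 2 * (1 / m) := by ring
      linarith
    · push Not at hsm
      rw [div_lt_iff₀ hm0] at hsm
      obtain ⟨j, hj⟩ : ∃ j : ℕ, ⌈v * m⌉₊ = j + 1 :=
        Nat.exists_eq_succ_of_ne_zero (by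
          have : 0 < ⌈v * m⌉₊ := Nat.ceil_pos.2 (by linarith)
          omega)
      have a1 : v * m ≤ j + 1 := by
        have := Nat.le_ceil (v * m); rw [hj] at this; exact_mod_cast this
      have a2 : (j : ℝ) < v * m := by
        apply Nat.lt_ceil.1; omega
      have j0 : 0 < j := by
        have : (0 : ℝ) < j := by linarith
        exact_mod_cast this
      have jm : j < m := by
        have : (j : ℝ) < m := by nlinarith
        exact_mod_cast this
      have e1 := ht j j0 jm
      have e2 := abs_lt.1 (hb j (Finset.mem_range.2 jm))
      have e3 : (j : ℝ) / m < v := by rwa [div_lt_iff₀ hm0]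
      have e4 : v - 1 / m ≤ (j : ℝ) / m := by
        rw [le_div_iff₀ hm0]; nlinarith
      have sub : Iic (t j) ⊆ L := by
        rcases hcase (t j) with h | h
        · exact h
        · have := measureReal_mono (μ := (ν : Measure ℝ)) h
          linarith
      have := measureReal_mono (μ := (νs n : Measure ℝ)) sub
      linarith
  · by_cases hsm : 1 - 2 / m ≤ v
    · have : 2 / (m : ℝ) = 2 * (1 / m) := by ring
      linarith
    · push Not at hsm
      have hsm' : v * m < m - 2 := by
        have : (1 - 2 / (m : ℝ)) * m = m - 2 := by field_simp
        nlinarith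
      set j := ⌊v * m⌋₊ + 1 with hj
      have a1 : v * m < j := by
        rw [hj]; push_cast; exact Nat.lt_floor_add_one _
      have a2 : (j : ℝ) ≤ v * m + 1 := by
        rw [hj]; push_cast
        have := Nat.floor_le (a := v * m) (by positivity)
        linarith
      have j0 : 0 < j := by omega
      have jm : j < m := by
        have : (j : ℝ) < m := by linarith
        exact_mod_cast this
      have e1 := ht j j0 jm
      have e2 := abs_lt.1 (hb j (Finset.mem_range.2 jm))
      have e3 : v < (j : ℝ) / m := by rwa [lt_div_iff₀ hm0]
      have e4 : (j : ℝ) / m ≤ v + 1 / m := by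
        rw [div_le_iff₀ hm0]; nlinarith
      have sub : L ⊆ Iic (t j) := by
        rcases hcase (t j) with h | h
        · have := measureReal_mono (μ := (ν : Measure ℝ)) h
          linarith
        · exact h
      have := measureReal_mono (μ := (νs n : Measure ℝ)) sub
      linarith

lemma aux_intervals (νs : ℕ → ProbabilityMeasure ℝ) (ν : ProbabilityMeasure ℝ)
    (h : Tendsto νs atTop (nhds ν)) (hat : ∀ c, (ν : Measure ℝ) {c} = 0) (ε : ℝ) (hε : 0 < ε) :
    ∃ N, ∀ n, N ≤ n → ∀ I : Set ℝ, I.OrdConnected →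
      |(νs n : Measure ℝ).real I - (ν : Measure ℝ).real I| < ε := by
  obtain ⟨N, hN⟩ := aux_polya νs ν h hat (ε / 2) (by positivity)
  refine ⟨N, fun n hn I hI => ?_⟩
  let L : Set ℝ := {x | ∃ y ∈ I, x ≤ y}
  let M : Set ℝ := {x | (∃ y ∈ I, x ≤ y) ∧ ∀ y ∈ I, x < y}
  have hL : IsLowerSet L := fun a b hba ⟨y, hy, hay⟩ => ⟨y, hy, hba.trans hay⟩
  have hM : IsLowerSet M := fun a b hba ⟨⟨y, hy, hay⟩, h2⟩ =>
    ⟨⟨y, hy, hba.trans hay⟩, fun z hz => lt_of_le_of_lt hba (h2 z hz)⟩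
  have hML : M ⊆ L := fun x hx => hx.1
  have hIe : I = L \ M := by
    ext x
    constructor
    · intro hx
      exact ⟨⟨x, hx, le_rfl⟩, fun hx' => lt_irrefl _ (hx'.2 x hx)⟩
    · rintro ⟨⟨y, hy, hxy⟩, h2⟩
      have : ∃ z ∈ I, z ≤ x := by
        by_contra hc
        push Not at hc
        exact h2 ⟨⟨y, hy, hxy⟩, hc⟩
      obtain ⟨z, hz, hzx⟩ := this
      exact hI.out hz hy ⟨hzx, hxy⟩
  have hMm : MeasurableSet M := hM.ordConnected.measurableSet
  have h1 := abs_lt.1 (hN n hn L hL)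
  have h2 := abs_lt.1 (hN n hn M hM)
  rw [hIe, measureReal_sdiff hML hMm, measureReal_sdiff hML hMm, abs_lt]
  constructor <;> linarith

lemma aux_core (ρ : ℝ) (hirr : Irrational ρ)
    (γ φ : AddCircle (1 : ℝ) → AddCircle (1 : ℝ)) (hγ : Continuous γ)
    (hconj : ∀ x, γ (φ x) = γ x + (ρ : AddCircle (1 : ℝ)))
    (φs : ℕ → AddCircle (1 : ℝ) → AddCircle (1 : ℝ)) (hu : TendstoUniformly φs φ atTop)
    (μs : ℕ → Measure (AddCircle (1 : ℝ))) (hp : ∀ n, IsProbabilityMeasure (μs n))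
    (hinv : ∀ n, Measure.map (φs n) (μs n) = μs n) (f : C(AddCircle (1 : ℝ), ℂ)) :
    Tendsto (fun n => ∫ x, f (γ x) ∂(μs n)) atTop (nhds (∫ x, f x ∂AddCircle.haarAddCircle)) := by
  have hint : ∀ (g : C(AddCircle (1 : ℝ), ℂ)) (n), Integrable (fun x => g (γ x)) (μs n) := by
    intro g n
    have : Continuous fun x => g (γ x) := by fun_prop
    exact this.integrable_of_hasCompactSupport (HasCompactSupport.of_compactSpace _)
  have hint' : ∀ (g : C(AddCircle (1 : ℝ), ℂ)), Integrable (fun x => g x)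
      (AddCircle.haarAddCircle (T := 1)) := by
    intro g
    have : Continuous fun x => g x := by fun_prop
    exact this.integrable_of_hasCompactSupport (HasCompactSupport.of_compactSpace _)
  have hae : ∀ n, AEMeasurable (φs n) (μs n) := fun n =>
    AEMeasurable.of_map_ne_zero (by rw [hinv n]; exact IsProbabilityMeasure.ne_zero _)
  -- Fourier modes
  have hfour : ∀ k : ℤ, Tendsto (fun n => ∫ x, fourier k (γ x) ∂(μs n)) atTop
      (nhds (∫ x, fourier k x ∂(AddCircle.haarAddCircle (T := 1)))) := by
    intro k
    by_cases hk : k = 0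
    · subst hk
      simp
    · have hz : ∫ x, fourier k x ∂(AddCircle.haarAddCircle (T := 1)) = 0 := by
        have h1 := congrFun (fourierCoeff_fourier (T := 1) k) 0
        rw [Pi.single_eq_of_ne (Ne.symm hk)] at h1
        simpa [fourierCoeff] using h1
      rw [hz]
      set c : ℂ := fourier k (ρ : AddCircle (1 : ℝ)) with hc
      have hc1 : 1 - c ≠ 0 := by
        intro h0
        have h1 : c = 1 := (sub_eq_zero.1 h0).symm
        rw [hc, fourier_coe_apply, Complex.exp_eq_one_iff] at h1
        obtain ⟨m, hm⟩ := h1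
        have h2 : ((k * ρ : ℝ) : ℂ) = ((m : ℝ) : ℂ) := by
          have hpi : (2 * Real.pi * Complex.I : ℂ) ≠ 0 := Complex.two_pi_I_ne_zero
          apply mul_right_cancel₀ hpi
          push_cast
          rw [← hm]
          push_cast
          ring
        have h3 : (k : ℝ) * ρ = m := by exact_mod_cast h2
        exact (hirr.intCast_mul hk).ne_int m h3
      have hadd : ∀ x, fourier k (γ (φ x)) = c * fourier k (γ x) := by
        intro x
        rw [hconj, fourier_apply, smul_add, AddCircle.toCircle_add, hc, fourier_apply, fourier_apply]
        push_cast
        ring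
      have hdiff : Tendsto (fun n => (1 - c) * ∫ x, fourier k (γ x) ∂(μs n)) atTop (nhds 0) := by
        have huc : UniformContinuous (fun x => (fourier k (γ x) : ℂ)) :=
          CompactSpace.uniformContinuous_of_continuous (by fun_prop)
        have hu2 := huc.comp_tendstoUniformly hu
        rw [Metric.tendstoUniformly_iff] at hu2
        rw [Metric.tendsto_nhds]
        intro ε hε
        filter_upwards [hu2 (ε / 2) (by positivity)] with n hn
        have e1 : ∫ x, fourier k (γ x) ∂(μs n) = ∫ x, fourier k (γ (φs n x)) ∂(μs n) := by
          conv_lhs => rw [← hinv n]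
          rw [integral_map (hae n)]
          rw [hinv n]
          exact (hint (fourier k) n).aestronglyMeasurable
        have i1 : Integrable (fun x => (fourier k (γ (φs n x)) : ℂ)) (μs n) := by
          have := hint (fourier k) n
          rw [← hinv n] at this
          exact this.comp_aemeasurable (hae n)
        have i2 : Integrable (fun x => c * (fourier k (γ x) : ℂ)) (μs n) :=
          (hint (fourier k) n).const_mul c
        have e2 : (1 - c) * ∫ x, fourier k (γ x) ∂(μs n)
            = ∫ x, (fourier k (γ (φs n x)) - c * fourier k (γ x)) ∂(μs n) := by
          rw [integral_sub i1 i2, ← e1, integral_const_mul]; ring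
        rw [e2, dist_zero_right]
        calc _ ≤ (ε / 2) * (μs n).real univ := by
              apply norm_integral_le_of_norm_le_const
              refine Eventually.of_forall fun x => ?_
              have := hn x
              rw [dist_comm, dist_eq_norm] at this
              simp only [Function.comp] at this
              rw [hadd] at this
              exact this.le
          _ < ε := by simp; linarith
      have := hdiff.const_mul ((1 - c)⁻¹)
      simpa [← mul_assoc, inv_mul_cancel₀ hc1] using this
  have hspan : ∀ g ∈ Submodule.span ℂ (range (fourier (T := 1))),
      Tendsto (fun n => ∫ x, g (γ x) ∂(μs n)) atTop
      (nhds (∫ x, g x ∂AddCircle.haarAddCircle)) := by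
    intro g hg
    induction hg using Submodule.span_induction with
    | mem x hx => obtain ⟨k, rfl⟩ := hx; exact hfour k
    | zero => simp
    | add x y _ _ hx hy =>
      have := hx.add hy
      simp only [ContinuousMap.add_apply]
      rw [integral_add (hint' x) (hint' y)]
      refine this.congr fun n => ?_
      rw [integral_add (hint x n) (hint y n)]
    | smul a x _ hx =>
      have := hx.const_mul a
      simp only [ContinuousMap.smul_apply, smul_eq_mul]
      simp_rw [integral_const_mul]
      exact this
  have hf : f ∈ closure ((Submodule.span ℂ (range (fourier (T := 1))) :
      Submodule ℂ C(AddCircle (1 : ℝ), ℂ)) : Set C(AddCircle (1 : ℝ), ℂ)) := by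
    rw [← Submodule.topologicalClosure_coe, span_fourier_closure_eq_top]; trivial
  rw [Metric.tendsto_nhds]
  intro ε hε
  obtain ⟨g, hg, hfg⟩ := Metric.mem_closure_iff.1 hf (ε / 3) (by positivity)
  rw [dist_eq_norm] at hfg
  have hpt : ∀ x, ‖f x - g x‖ ≤ ε / 3 := fun x =>
    ((f - g).norm_coe_le_norm x).trans hfg.le
  filter_upwards [Metric.tendsto_nhds.1 (hspan g hg) (ε / 3) (by positivity)] with n hn
  have b1 : ‖∫ x, f (γ x) ∂(μs n) - ∫ x, g (γ x) ∂(μs n)‖ ≤ ε / 3 := by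
    rw [← integral_sub (hint f n) (hint g n)]
    simpa using norm_integral_le_of_norm_le_const (μ := μs n)
      (Eventually.of_forall fun x => hpt (γ x))
  have b2 : ‖∫ x, f x ∂(AddCircle.haarAddCircle (T := 1)) - ∫ x, g x ∂AddCircle.haarAddCircle‖
      ≤ ε / 3 := by
    rw [← integral_sub (hint' f) (hint' g)]
    simpa using norm_integral_le_of_norm_le_const (μ := AddCircle.haarAddCircle (T := 1))
      (Eventually.of_forall fun x => hpt x)
  rw [← dist_eq_norm] at b1 b2
  rw [dist_comm] at b2
  have := dist_triangle4 (∫ x, f (γ x) ∂(μs n)) (∫ x, g (γ x) ∂(μs n))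
    (∫ x, g x ∂AddCircle.haarAddCircle) (∫ x, f x ∂AddCircle.haarAddCircle)
  linarith

lemma aux_core_real (ρ : ℝ) (hirr : Irrational ρ)
    (γ φ : AddCircle (1 : ℝ) → AddCircle (1 : ℝ)) (hγ : Continuous γ)
    (hconj : ∀ x, γ (φ x) = γ x + (ρ : AddCircle (1 : ℝ)))
    (φs : ℕ → AddCircle (1 : ℝ) → AddCircle (1 : ℝ)) (hu : TendstoUniformly φs φ atTop)
    (μs : ℕ → Measure (AddCircle (1 : ℝ))) (hp : ∀ n, IsProbabilityMeasure (μs n))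
    (hinv : ∀ n, Measure.map (φs n) (μs n) = μs n) (f : AddCircle (1 : ℝ) → ℝ)
    (hf : Continuous f) :
    Tendsto (fun n => ∫ x, f (γ x) ∂(μs n)) atTop (nhds (∫ x, f x ∂AddCircle.haarAddCircle)) := by
  have := aux_core ρ hirr γ φ hγ hconj φs hu μs hp hinv
    ⟨fun x => ((f x : ℝ) : ℂ), by fun_prop⟩
  simp only [ContinuousMap.coe_mk, integral_complex_ofReal] at this
  exact_mod_cast (Complex.continuous_re.tendsto _).comp this

lemma aux_level (Φ Φ' : ℝ → ℝ) (hΦderiv : ∀ x : ℝ, HasDerivAt Φ (Φ' x) x)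
    (hC : volume {x ∈ Icc (0 : ℝ) 1 | Φ' x = 1} = 0) (c : ℝ) :
    volume ({x | Φ x - x = c} ∩ Ioc (0 : ℝ) 1) = 0 := by
  have hcount : ({x | Φ x - x = c ∧ Φ' x ≠ 1} : Set ℝ).Countable := by
    apply IsLindelof.countable (HereditarilyLindelofSpace.isLindelof _)
    rw [discreteTopology_subtype_iff]
    rintro x ⟨_, hx2⟩
    have h1 : HasDerivAt (fun x => Φ x - x) (Φ' x - 1) x := (hΦderiv x).sub (hasDerivAt_id x)
    have h2 := h1.eventually_ne (c := c) (sub_ne_zero.2 hx2)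
    rw [← disjoint_iff]
    rw [Filter.disjoint_principal_right]
    filter_upwards [h2] with z hz hz'
    exact hz hz'.1
  refine measure_mono_null ?_ (measure_union_null hC (hcount.measure_zero volume))
  rintro x ⟨hx, hx2⟩
  by_cases h : Φ' x = 1
  · exact Or.inl ⟨Ioc_subset_Icc_self hx2, h⟩
  · exact Or.inr ⟨hx, h⟩

/-- Uniform convergence of displacement distributions on intervals:
if lifts `Φₙ` (irrational rotation numbers) converge uniformly to a `C¹` diffeomorphism
lift `Φ` whose conjugacy `Γ` with the translation by `ρ` is a `C¹`-diffeomorphism and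
whose displacement has critical set of measure zero, then the displacement distributions
`μ_Ψ⁽ⁿ⁾` of the unique invariant measures converge to `μ_Ψ` uniformly over all
intervals (`OrdConnected` subsets of `ℝ`). -/
theorem displacement_distributions_uniform_on_intervals
    (Φseq : ℕ → ℝ → ℝ)
    (hcontn : ∀ n, Continuous (Φseq n)) (hmonon : ∀ n, StrictMono (Φseq n))
    (hbijn : ∀ n, Function.Bijective (Φseq n))
    (hliftn : ∀ n, ∀ x : ℝ, Φseq n (x + 1) = Φseq n x + 1)
    (ρseq : ℕ → ℝ) (hirrn : ∀ n, Irrational (ρseq n))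
    (hrotn : ∀ n, ∀ x : ℝ,
      Tendsto (fun m : ℕ => (Φseq n)^[m] x / m) atTop (nhds (ρseq n)))
    (Φ Φ' : ℝ → ℝ) (hΦderiv : ∀ x : ℝ, HasDerivAt Φ (Φ' x) x)
    (hΦ'cont : Continuous Φ') (hΦ'pos : ∀ x : ℝ, 0 < Φ' x)
    (hmono : StrictMono Φ) (hbij : Function.Bijective Φ)
    (hlift : ∀ x : ℝ, Φ (x + 1) = Φ x + 1)
    (ρ : ℝ) (hirr : Irrational ρ)
    (hrot : ∀ x : ℝ, Tendsto (fun m : ℕ => Φ^[m] x / m) atTop (nhds ρ))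
    (hunif : TendstoUniformly Φseq Φ atTop)
    (Γ Γ' : ℝ → ℝ) (hΓderiv : ∀ x : ℝ, HasDerivAt Γ (Γ' x) x)
    (hΓ'cont : Continuous Γ') (hΓ'pos : ∀ x : ℝ, 0 < Γ' x)
    (hΓmono : StrictMono Γ) (hΓbij : Function.Bijective Γ)
    (hΓlift : ∀ x : ℝ, Γ (x + 1) = Γ x + 1)
    (hconj : ∀ x : ℝ, Γ (Φ x) = Γ x + ρ)
    (hC : volume {x ∈ Icc (0 : ℝ) 1 | Φ' x = 1} = 0)
    (φseq : ℕ → AddCircle (1 : ℝ) → AddCircle (1 : ℝ))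
    (φ : AddCircle (1 : ℝ) → AddCircle (1 : ℝ))
    (hφn : ∀ n, ∀ x : ℝ, φseq n (x : AddCircle (1 : ℝ)) = ((Φseq n x : ℝ) : AddCircle (1 : ℝ)))
    (hφ : ∀ x : ℝ, φ (x : AddCircle (1 : ℝ)) = ((Φ x : ℝ) : AddCircle (1 : ℝ)))
    (μseq : ℕ → Measure (AddCircle (1 : ℝ))) (μ : Measure (AddCircle (1 : ℝ)))
    (hprobn : ∀ n, IsProbabilityMeasure (μseq n)) (hprob : IsProbabilityMeasure μ)
    (hinvn : ∀ n, Measure.map (φseq n) (μseq n) = μseq n)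
    (hinv : Measure.map φ μ = μ)
    (ψbseq : ℕ → AddCircle (1 : ℝ) → ℝ) (ψb : AddCircle (1 : ℝ) → ℝ)
    (hψbn : ∀ n, Continuous (ψbseq n))
    (hψn : ∀ n, ∀ x : ℝ, ψbseq n (x : AddCircle (1 : ℝ)) = Φseq n x - x)
    (hψbcont : Continuous ψb)
    (hψ : ∀ x : ℝ, ψb (x : AddCircle (1 : ℝ)) = Φ x - x) :
    ∀ ε : ℝ, 0 < ε → ∃ N : ℕ, ∀ n : ℕ, N ≤ n → ∀ I : Set ℝ, I.OrdConnected →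
      |(Measure.map (ψbseq n) (μseq n) I).toReal - (Measure.map ψb μ I).toReal| < ε := by
  -- the circle conjugacy
  have hper : Function.Periodic (fun x : ℝ => ((Γ x : ℝ) : AddCircle (1 : ℝ))) 1 := by
    intro x
    simp only [hΓlift]
    rw [AddCircle.coe_add, AddCircle.coe_period, add_zero]
  have hΓcont : Continuous Γ := continuous_iff_continuousAt.2 fun x => (hΓderiv x).continuousAt
  let γ : AddCircle (1 : ℝ) → AddCircle (1 : ℝ) := hper.lift
  have hγ : ∀ x : ℝ, γ (x : AddCircle (1 : ℝ)) = ((Γ x : ℝ) : AddCircle (1 : ℝ)) := fun x => rfl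
  have hγcont : Continuous γ := by
    have hq : IsOpenQuotientMap (QuotientAddGroup.mk : ℝ → AddCircle (1 : ℝ)) :=
      QuotientAddGroup.isOpenQuotientMap_mk
    rw [hq.isQuotientMap.continuous_iff]
    exact (AddCircle.continuous_mk' (1 : ℝ)).comp hΓcont
  have hΓint : ∀ (m : ℤ) (x : ℝ), Γ (x + m) = Γ x + m := by
    intro m x
    have hp : Function.Periodic (fun x => Γ x - x) 1 := by
      intro x; simp only [hΓlift]; ring
    have := hp.int_mul m x
    simp only [mul_one] at this
    linarith
  have hγinj : Function.Injective γ := by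
    intro a b hab
    induction a using QuotientAddGroup.induction_on with
    | H x =>
    induction b using QuotientAddGroup.induction_on with
    | H y =>
    have h1 : ((Γ x : ℝ) : AddCircle (1 : ℝ)) = ((Γ y : ℝ) : AddCircle (1 : ℝ)) := hab
    rw [← sub_eq_zero, ← AddCircle.coe_sub, AddCircle.coe_eq_zero_iff] at h1
    obtain ⟨m, hm⟩ := h1
    have h2 : Γ x = Γ (y + m) := by
      rw [hΓint]; simp at hm; linarith
    have h3 := hΓmono.injective h2
    change ((x : ℝ) : AddCircle (1 : ℝ)) = ((y : ℝ) : AddCircle (1 : ℝ))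
    rw [← sub_eq_zero, ← AddCircle.coe_sub, AddCircle.coe_eq_zero_iff]
    exact ⟨m, by simp; linarith⟩
  have hγsurj : Function.Surjective γ := by
    intro a
    induction a using QuotientAddGroup.induction_on with
    | H y =>
    obtain ⟨x, rfl⟩ := hΓbij.2 y
    exact ⟨(x : AddCircle (1 : ℝ)), rfl⟩
  let e : AddCircle (1 : ℝ) ≃ₜ AddCircle (1 : ℝ) :=
    Continuous.homeoOfEquivCompactToT2 (f := Equiv.ofBijective γ ⟨hγinj, hγsurj⟩) hγcont
  have he : ∀ x, e x = γ x := fun x => rfl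
  have hγconj : ∀ x, γ (φ x) = γ x + (ρ : AddCircle (1 : ℝ)) := by
    intro a
    induction a using QuotientAddGroup.induction_on with
    | H x =>
    change γ (φ (x : AddCircle (1 : ℝ))) = γ (x : AddCircle (1 : ℝ)) + _
    rw [hφ, hγ, hγ, hconj, AddCircle.coe_add]
  have huφ : TendstoUniformly φseq φ atTop := by
    rw [Metric.tendstoUniformly_iff] at hunif ⊢
    intro ε hε
    filter_upwards [hunif ε hε] with n hn a
    induction a using QuotientAddGroup.induction_on with
    | H x =>
    change dist (φ (x : AddCircle (1 : ℝ))) (φseq n (x : AddCircle (1 : ℝ))) < ε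
    rw [hφ, hφn, dist_eq_norm, ← AddCircle.coe_sub]
    exact lt_of_le_of_lt QuotientAddGroup.norm_mk_le_norm (by simpa [dist_eq_norm] using hn x)
  have huψ : TendstoUniformly ψbseq ψb atTop := by
    rw [Metric.tendstoUniformly_iff] at hunif ⊢
    intro ε hε
    filter_upwards [hunif ε hε] with n hn a
    induction a using QuotientAddGroup.induction_on with
    | H x =>
    change dist (ψb (x : AddCircle (1 : ℝ))) (ψbseq n (x : AddCircle (1 : ℝ))) < ε
    rw [hψ, hψn]
    simpa using hn x
  -- identification of the invariant measure
  have hμint : ∀ f : AddCircle (1 : ℝ) → ℝ, Continuous f →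
      ∫ x, f (γ x) ∂μ = ∫ x, f x ∂AddCircle.haarAddCircle := by
    intro f hf
    have h0 : TendstoUniformly (fun _ : ℕ => φ) φ atTop := by
      rw [Metric.tendstoUniformly_iff]
      intro ε hε
      exact Eventually.of_forall fun n x => by simpa using hε
    have := aux_core_real ρ hirr γ φ hγcont hγconj (fun _ => φ) h0 (fun _ => μ)
      (fun _ => hprob) (fun _ => hinv) f hf
    exact tendsto_nhds_unique tendsto_const_nhds this
  have hmap : Measure.map γ μ = AddCircle.haarAddCircle := by
    haveI := Measure.isProbabilityMeasure_map (μ := μ) hγcont.measurable.aemeasurable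
    apply ext_of_forall_integral_eq_of_IsFiniteMeasure
    intro f
    rw [integral_map hγcont.measurable.aemeasurable f.continuous.aestronglyMeasurable]
    exact hμint f f.continuous
  -- weak convergence
  have hweak : ∀ g : AddCircle (1 : ℝ) → ℝ, Continuous g →
      Tendsto (fun n => ∫ x, g x ∂(μseq n)) atTop (nhds (∫ x, g x ∂μ)) := by
    intro g hg
    have hc : Continuous (fun x => g (e.symm x)) := hg.comp e.symm.continuous
    have h1 := aux_core_real ρ hirr γ φ hγcont hγconj φseq huφ μseq hprobn hinvn _ hc
    rw [← hμint _ hc] at h1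
    simpa [← he] using h1
  -- no atoms
  have hatom : ∀ c, Measure.map ψb μ {c} = 0 := by
    intro c
    rw [Measure.map_apply hψbcont.measurable (measurableSet_singleton c)]
    set A := ψb ⁻¹' {c} with hA
    have hAm : MeasurableSet A := hψbcont.measurable (measurableSet_singleton c)
    have hBm : MeasurableSet (γ '' A) := e.measurableEmbedding.measurableSet_image.2 hAm
    have h1 : μ A = AddCircle.haarAddCircle (γ '' A) := by
      rw [← hmap, Measure.map_apply hγcont.measurable hBm, preimage_image_eq _ hγinj]
    have hvol : (volume : Measure (AddCircle (1 : ℝ))) = AddCircle.haarAddCircle := by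
      rw [AddCircle.volume_eq_smul_haarAddCircle]; simp
    have hmp := AddCircle.measurePreserving_mk (1 : ℝ) (Γ 0)
    rw [h1, ← hvol, ← hmp.measure_preimage hBm.nullMeasurableSet,
      Measure.restrict_apply (hmp.measurable hBm)]
    have hnull : volume (Γ '' ({x | Φ x - x = c} ∩ Ioc (0 : ℝ) 1)) = 0 :=
      addHaar_image_eq_zero_of_differentiableOn_of_addHaar_eq_zero volume
        (fun x _ => (hΓderiv x).differentiableAt.differentiableWithinAt)
        (aux_level Φ Φ' hΦderiv hC c)
    refine measure_mono_null ?_ hnull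
    rintro y ⟨hy1, hy2⟩
    obtain ⟨x, rfl⟩ := hΓbij.2 y
    refine ⟨x, ⟨?_, ?_⟩, rfl⟩
    · obtain ⟨a, ha, hax⟩ := hy1
      have : a = (x : AddCircle (1 : ℝ)) := hγinj hax
      rw [this] at ha
      have h3 : ψb (x : AddCircle (1 : ℝ)) = c := ha
      rw [hψ] at h3
      exact h3
    · have h01 : Γ 0 + 1 = Γ 1 := by rw [← hΓlift]; simp
      rw [h01] at hy2
      exact ⟨hΓmono.lt_iff_lt.1 hy2.1, hΓmono.le_iff_le.1 hy2.2⟩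
  -- conclusion
  have hpn : ∀ n, IsProbabilityMeasure (Measure.map (ψbseq n) (μseq n)) := fun n =>
    Measure.isProbabilityMeasure_map (hψbn n).measurable.aemeasurable
  have hp : IsProbabilityMeasure (Measure.map ψb μ) :=
    Measure.isProbabilityMeasure_map hψbcont.measurable.aemeasurable
  let νs : ℕ → ProbabilityMeasure ℝ := fun n => ⟨Measure.map (ψbseq n) (μseq n), hpn n⟩
  let ν : ProbabilityMeasure ℝ := ⟨Measure.map ψb μ, hp⟩
  have hlim : Tendsto νs atTop (nhds ν) := by
    rw [tendsto_iff_forall_lipschitz_integral_tendsto]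
    rintro f - ⟨K, hK⟩
    have hfc := hK.continuous
    change Tendsto (fun n => ∫ t, f t ∂(Measure.map (ψbseq n) (μseq n))) atTop
      (nhds (∫ t, f t ∂(Measure.map ψb μ)))
    rw [integral_map hψbcont.measurable.aemeasurable hfc.aestronglyMeasurable]
    have hw := hweak (fun x => f (ψb x)) (hfc.comp hψbcont)
    have hu2 := hK.uniformContinuous.comp_tendstoUniformly huψ
    rw [Metric.tendstoUniformly_iff] at hu2
    rw [Metric.tendsto_nhds] at hw ⊢
    intro ε hε
    filter_upwards [hw (ε / 2) (by positivity), hu2 (ε / 2) (by positivity)] with n h1 h2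
    rw [integral_map (hψbn n).measurable.aemeasurable hfc.aestronglyMeasurable]
    have i1 : Integrable (fun x => f (ψbseq n x)) (μseq n) :=
      (hfc.comp (hψbn n)).integrable_of_hasCompactSupport (HasCompactSupport.of_compactSpace _)
    have i2 : Integrable (fun x => f (ψb x)) (μseq n) :=
      (hfc.comp hψbcont).integrable_of_hasCompactSupport (HasCompactSupport.of_compactSpace _)
    have b : dist (∫ x, f (ψbseq n x) ∂(μseq n)) (∫ x, f (ψb x) ∂(μseq n)) ≤ ε / 2 := by
      rw [dist_eq_norm, ← integral_sub i1 i2]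
      have : ∀ x, ‖f (ψbseq n x) - f (ψb x)‖ ≤ ε / 2 := fun x => by
        have := h2 x
        rw [dist_comm, dist_eq_norm] at this
        exact this.le
      simpa using norm_integral_le_of_norm_le_const (μ := μseq n) (Eventually.of_forall this)
    exact lt_of_le_of_lt (dist_triangle _ _ _) (by linarith)
  intro ε hε
  exact aux_intervals νs ν hlim hatom ε hε
end
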